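/- arXiv:1607.07392 — 5 statements merged into one kernel-verified Lean document; each statement's English description precedes it below -/
import Mathlib

section
/- Let f : [0,∞) → [0,∞) be measurable and locally integrable, and define F(x) = ∫₀ˣ f(z) dz for x ≥ 0, g(y) = f(e^y) and G(y) = ∫₀^y g(z) dz for y ∈ ℝ (oriented integral, negative for y < 0 when applicable). Then for every y ∈ ℝ, G(y) = F(e^y)/e^y + ∫₀^y F(e^u) e^{-u} du - F(1). -/
open MeasureTheory Real Set

/-- Substitution `z = exp u` in an interval integral. -/
lemma intervalIntegral_comp_exp_mul_exp (f : ℝ → ℝ) (a b : ℝ) :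
    ∫ u in a..b, f (exp u) * exp u = ∫ z in exp a..exp b, f z :=
  intervalIntegral.integral_comp_mul_deriv_of_deriv_nonneg continuous_exp.continuousOn
    (fun x _ => hasDerivAt_exp x) (fun x _ => (exp_pos x).le)

lemma intervalIntegrable_comp_exp_mul_exp_iff {f : ℝ → ℝ} {a b : ℝ} :
    IntervalIntegrable (fun u => f (exp u) * exp u) volume a b ↔
      IntervalIntegrable f volume (exp a) (exp b) :=
  intervalIntegral.integrable_comp_mul_deriv_iff_of_deriv_nonneg continuous_exp.continuousOn
    (fun x _ => hasDerivAt_exp x) (fun x _ => (exp_pos x).le)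

/-- Integration by parts of `h` against `exp (-u)`, where the antiderivative of the merely
integrable function `h` is `c + ∫ t in a..u, h t`. -/
lemma intervalIntegral_mul_exp_neg {h : ℝ → ℝ} {a b : ℝ} (hh : IntervalIntegrable h volume a b)
    (c : ℝ) :
    ∫ u in a..b, h u * exp (-u) =
      (c + ∫ t in a..b, h t) * exp (-b) - c * exp (-a) +
        ∫ u in a..b, (c + ∫ t in a..u, h t) * exp (-u) := by
  have hP : AbsolutelyContinuousOnInterval (fun u => c + ∫ t in a..u, h t) a b :=
    (contDiffOn_const (n := 1)).absolutelyContinuousOnInterval.add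
      (hh.absolutelyContinuousOnInterval_intervalIntegral (c := a) left_mem_uIcc)
  have hQ : AbsolutelyContinuousOnInterval (fun u : ℝ => exp (-u)) a b :=
    ContDiffOn.absolutelyContinuousOnInterval (by fun_prop)
  have hQ' : deriv (fun u : ℝ => exp (-u)) = fun u => -exp (-u) := by
    funext u
    simpa using ((hasDerivAt_neg u).exp).deriv
  have hparts := hP.integral_mul_deriv_eq_deriv_mul hQ
  have hderiv : ∫ u in a..b, deriv (fun u => c + ∫ t in a..u, h t) u * exp (-u) =
      ∫ u in a..b, h u * exp (-u) := by
    apply intervalIntegral.integral_congr_ae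
    filter_upwards [hh.ae_hasDerivAt_integral] with u hu hmem
    rw [((hu (uIoc_subset_uIcc hmem) a left_mem_uIcc).const_add c).deriv]
  rw [hderiv, hQ'] at hparts
  simp only [mul_neg, intervalIntegral.integral_neg, intervalIntegral.integral_same,
    add_zero] at hparts
  linarith

theorem stmt_2 (f : ℝ → ℝ) (hmeas : Measurable f)
    (hnn : ∀ x, 0 ≤ x → 0 ≤ f x)
    (hloc : ∀ x : ℝ, 0 ≤ x → MeasureTheory.IntegrableOn f (Set.Icc 0 x))
    (F G : ℝ → ℝ)
    (hF : ∀ x, F x = ∫ z in (0:ℝ)..x, f z)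
    (hG : ∀ y, G y = ∫ z in (0:ℝ)..y, f (Real.exp z)) :
    ∀ y : ℝ, G y = F (Real.exp y) / Real.exp y +
      (∫ u in (0:ℝ)..y, F (Real.exp u) * Real.exp (-u)) - F 1 := by
  intro y
  have hint : ∀ x : ℝ, 0 ≤ x → IntervalIntegrable f volume 0 x := fun x hx =>
    (intervalIntegrable_iff_integrableOn_Icc_of_le hx).2 (hloc x hx)
  have hFexp : ∀ u, F (exp u) = F 1 + ∫ t in (0:ℝ)..u, f (exp t) * exp t := by
    intro u
    rw [intervalIntegral_comp_exp_mul_exp, exp_zero, hF, hF]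
    have h1 := hint 1 zero_le_one
    exact (intervalIntegral.integral_add_adjacent_intervals h1
      (h1.symm.trans (hint _ (exp_pos u).le))).symm
  have hh : IntervalIntegrable (fun u => f (exp u) * exp u) volume 0 y := by
    rw [intervalIntegrable_comp_exp_mul_exp_iff, exp_zero]
    exact (hint 1 zero_le_one).symm.trans (hint _ (exp_pos y).le)
  have hcancel : ∀ u, f (exp u) * exp u * exp (-u) = f (exp u) := fun u => by
    rw [mul_assoc, ← exp_add, add_neg_cancel, exp_zero, mul_one]
  have key := intervalIntegral_mul_exp_neg hh (F 1)
  simp only [← hFexp, hcancel, neg_zero, exp_zero, mul_one] at key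
  rw [hG, key, div_eq_mul_inv, ← exp_neg]
  ring
end

section
/- Let T > 0, σ_Y > 0, σ_Z > 0 and m ∈ ℝ satisfy Δ := σ_Y² σ_Z² - T² > 0, and define p : ℝ² → ℝ by p(x,z) = (2π Δ^{1/2})^{-1} exp{ -(σ_Z² (x-m)² + σ_Y² z² - 2T (x-m) z) / (2Δ) }. Let G : ℝ → ℝ be measurable with |G(x)| ≤ C(1 + e^{p|x|}) for all x and some constants C, p > 0. Then the function (x,z) ↦ G(x) z p(x,z) is integrable on ℝ² and ∫_{ℝ²} G(x) z p(x,z) dx dz = (T/√(2π)) ∫_ℝ G(x) ((x - m)/σ_Y³) exp{ -(x-m)²/(2σ_Y²) } dx. -/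
open MeasureTheory Real Set

/-- The first moment of an unnormalised Gaussian centred at `c`. -/
theorem integral_mul_exp_neg_mul_sub_sq {b : ℝ} (hb : 0 < b) (c : ℝ) :
    ∫ z : ℝ, z * Real.exp (-b * (z - c) ^ 2) = c * √(π / b) := by
  have hodd : ∫ w : ℝ, w * Real.exp (-b * w ^ 2) = 0 := by
    have h := integral_neg_eq_self (fun w : ℝ => w * Real.exp (-b * w ^ 2)) volume
    simp only [neg_sq, neg_mul, integral_neg] at h ⊢
    linarith
  calc ∫ z : ℝ, z * Real.exp (-b * (z - c) ^ 2)
      = ∫ z : ℝ, ((z - c) + c) * Real.exp (-b * (z - c) ^ 2) := by simp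
    _ = ∫ w : ℝ, (w + c) * Real.exp (-b * w ^ 2) :=
        integral_sub_right_eq_self (fun w : ℝ => (w + c) * Real.exp (-b * w ^ 2)) c
    _ = c * √(π / b) := by
        simp_rw [add_mul]
        rw [integral_add (integrable_mul_exp_neg_mul_sq hb)
          ((integrable_exp_neg_mul_sq hb).const_mul c), hodd, integral_const_mul,
          integral_gaussian, zero_add]

/-- A function of at most exponential growth is dominated by a Gaussian once multiplied by a
Gaussian. -/
theorem one_add_exp_mul_abs_mul_exp_neg_le {a : ℝ} (ha : 0 < a) {q : ℝ} (hq : 0 ≤ q)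
    (m x : ℝ) :
    (1 + Real.exp (q * |x|)) * Real.exp (-a * (x - m) ^ 2) ≤
      (1 + Real.exp (q * |m| + q ^ 2 / (2 * a))) * Real.exp (-(a / 2) * (x - m) ^ 2) := by
  have hsplit : q * |x| ≤ q * |m| + q * |x - m| := by
    rw [← mul_add]
    gcongr
    simpa using abs_add_le m (x - m)
  have hyoung : q * |x - m| ≤ a / 2 * (x - m) ^ 2 + q ^ 2 / (2 * a) := by
    rw [← sq_abs (x - m), ← sub_nonneg]
    have : a / 2 * |x - m| ^ 2 + q ^ 2 / (2 * a) - q * |x - m| =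
        (a * |x - m| - q) ^ 2 / (2 * a) := by
      field_simp
      ring
    rw [this]
    positivity
  rw [add_mul, add_mul, one_mul, one_mul, ← Real.exp_add, ← Real.exp_add]
  have := mul_nonneg ha.le (sq_nonneg (x - m))
  gcongr ?_ + ?_
  · exact Real.exp_le_exp.2 (by linarith)
  · exact Real.exp_le_exp.2 (by linarith)

/-- A positive definite binary quadratic form dominates a positive multiple of its diagonal. -/
theorem exists_pos_mul_diag_le_quadratic {s t T : ℝ} (hT : 0 ≤ T) (hs : 0 < s) (ht : 0 < t)
    (h : 0 < s ^ 2 * t ^ 2 - T ^ 2) :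
    ∃ k : ℝ, 0 < k ∧ ∀ u z : ℝ, k * (t ^ 2 * u ^ 2 + s ^ 2 * z ^ 2) ≤
      t ^ 2 * u ^ 2 + s ^ 2 * z ^ 2 - 2 * T * u * z := by
  have hst : 0 < s * t := mul_pos hs ht
  have hlt : T < s * t := lt_of_pow_lt_pow_left₀ 2 hst.le (by rw [mul_pow]; linarith)
  refine ⟨1 - T / (s * t), sub_pos.2 ((div_lt_one hst).2 hlt), fun u z => ?_⟩
  have key : t ^ 2 * u ^ 2 + s ^ 2 * z ^ 2 - 2 * T * u * z -
      (1 - T / (s * t)) * (t ^ 2 * u ^ 2 + s ^ 2 * z ^ 2) =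
      T / (s * t) * (t * u - s * z) ^ 2 := by
    field_simp
    ring
  rw [← sub_nonneg, key]
  positivity

theorem stmt_7 (T σY σZ m : ℝ) (hT : 0 < T) (hσY : 0 < σY) (hσZ : 0 < σZ)
    (hΔ : 0 < σY ^ 2 * σZ ^ 2 - T ^ 2)
    (p : ℝ → ℝ → ℝ)
    (hp : ∀ x z, p x z =
      (2 * Real.pi * Real.sqrt (σY ^ 2 * σZ ^ 2 - T ^ 2))⁻¹ *
        Real.exp (-(σZ ^ 2 * (x - m) ^ 2 + σY ^ 2 * z ^ 2 - 2 * T * (x - m) * z) /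
          (2 * (σY ^ 2 * σZ ^ 2 - T ^ 2))))
    (G : ℝ → ℝ) (hGmeas : Measurable G)
    (C q : ℝ) (hC : 0 < C) (hq : 0 < q)
    (hGbound : ∀ x, |G x| ≤ C * (1 + Real.exp (q * |x|))) :
    Integrable (fun w : ℝ × ℝ => G w.1 * w.2 * p w.1 w.2) ∧
    ∫ w : ℝ × ℝ, G w.1 * w.2 * p w.1 w.2 =
      (T / Real.sqrt (2 * Real.pi)) *
        ∫ x : ℝ, G x * ((x - m) / σY ^ 3) * Real.exp (-(x - m) ^ 2 / (2 * σY ^ 2)) := by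
  set Δ := σY ^ 2 * σZ ^ 2 - T ^ 2 with hΔdef
  set N := (2 * Real.pi * √Δ)⁻¹ with hN
  have hN0 : 0 ≤ N := by positivity
  have hint : Integrable (fun w : ℝ × ℝ => G w.1 * w.2 * p w.1 w.2) := by
    obtain ⟨k, hk, hquad⟩ := exists_pos_mul_diag_le_quadratic hT.le hσY hσZ hΔ
    set a := k * σZ ^ 2 / (2 * Δ) with ha
    set b := k * σY ^ 2 / (2 * Δ) with hb
    have ha0 : 0 < a := by positivity
    have hb0 : 0 < b := by positivity
    set A := N * C * (1 + Real.exp (q * |m| + q ^ 2 / (2 * a))) with hA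
    have hx : Integrable (fun x : ℝ => A * Real.exp (-(a / 2) * (x - m) ^ 2)) :=
      ((integrable_exp_neg_mul_sq (half_pos ha0)).comp_sub_right m).const_mul A
    have hz : Integrable (fun z : ℝ => |z * Real.exp (-b * z ^ 2)|) :=
      (integrable_mul_exp_neg_mul_sq hb0).abs
    refine (hx.mul_prod hz).mono' ?_ (Filter.Eventually.of_forall fun w => ?_)
    · simp only [hp]
      exact (by fun_prop : Measurable _).aestronglyMeasurable
    · obtain ⟨x, z⟩ := w
      have hexp : Real.exp (-(σZ ^ 2 * (x - m) ^ 2 + σY ^ 2 * z ^ 2 - 2 * T * (x - m) * z) /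
          (2 * Δ)) ≤ Real.exp (-a * (x - m) ^ 2) * Real.exp (-b * z ^ 2) := by
        rw [← Real.exp_add, Real.exp_le_exp]
        have : -a * (x - m) ^ 2 + -b * z ^ 2 =
            -(k * (σZ ^ 2 * (x - m) ^ 2 + σY ^ 2 * z ^ 2)) / (2 * Δ) := by
          rw [ha, hb]
          ring
        rw [this]
        gcongr
        exact hquad (x - m) z
      simp only [hp, Real.norm_eq_abs, abs_mul, Real.abs_exp, abs_of_nonneg hN0]
      calc |G x| * |z| * (N * Real.exp _)
          ≤ C * (1 + Real.exp (q * |x|)) * |z| *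
            (N * (Real.exp (-a * (x - m) ^ 2) * Real.exp (-b * z ^ 2))) := by
            gcongr
            exact hGbound x
        _ = N * C * ((1 + Real.exp (q * |x|)) * Real.exp (-a * (x - m) ^ 2)) *
            (|z| * Real.exp (-b * z ^ 2)) := by ring
        _ ≤ N * C * ((1 + Real.exp (q * |m| + q ^ 2 / (2 * a))) *
            Real.exp (-(a / 2) * (x - m) ^ 2)) * (|z| * Real.exp (-b * z ^ 2)) := by
            gcongr ?_ * _
            exact mul_le_mul_of_nonneg_left
              (one_add_exp_mul_abs_mul_exp_neg_le ha0 hq.le m x) (by positivity)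
        _ = A * Real.exp (-(a / 2) * (x - m) ^ 2) * (|z| * Real.exp (-b * z ^ 2)) := by
            rw [hA]
            ring
  refine ⟨hint, ?_⟩
  rw [Measure.volume_eq_prod, integral_prod _ hint, ← integral_const_mul]
  congr 1
  ext x
  set b := σY ^ 2 / (2 * Δ) with hb
  have hb0 : 0 < b := by positivity
  have hsquare : ∀ z : ℝ, G x * z * p x z =
      G x * N * Real.exp (-(x - m) ^ 2 / (2 * σY ^ 2)) *
        (z * Real.exp (-b * (z - T * (x - m) / σY ^ 2) ^ 2)) := by
    intro z
    have : -(σZ ^ 2 * (x - m) ^ 2 + σY ^ 2 * z ^ 2 - 2 * T * (x - m) * z) / (2 * Δ) =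
        -(x - m) ^ 2 / (2 * σY ^ 2) + -b * (z - T * (x - m) / σY ^ 2) ^ 2 := by
      rw [hb]
      field_simp
      rw [hΔdef]
      ring
    rw [hp, this, Real.exp_add]
    ring
  have hsqrt : √(π / b) = √(2 * π) * √Δ / σY := by
    have : π / b = 2 * π * Δ / σY ^ 2 := by
      rw [hb]
      field_simp
    rw [this, Real.sqrt_div (by positivity), Real.sqrt_mul (by positivity),
      Real.sqrt_sq hσY.le]
  have hNsqrt : N * (√(2 * π) * √Δ) = 1 / √(2 * π) := by
    have h2 : √(2 * π) ^ 2 = 2 * π := Real.sq_sqrt (by positivity)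
    have hpos : 0 < √(2 * π) := by positivity
    generalize √(2 * π) = r at h2 hpos
    rw [hN, ← h2]
    field_simp
  simp only [hsquare]
  rw [integral_const_mul, integral_mul_exp_neg_mul_sub_sq hb0, hsqrt]
  calc _ = N * (√(2 * π) * √Δ) * (G x * Real.exp (-(x - m) ^ 2 / (2 * σY ^ 2)) *
        (T * (x - m) / σY ^ 3)) := by
        field_simp
    _ = _ := by
        rw [hNsqrt]
        ring
end

section
/- Let H ∈ (1/2, 1), c_H = (H - 1/2)·(2H Γ(3/2 - H)/(Γ(H + 1/2) Γ(2 - 2H)))^{1/2}, and for 0 < s < t define k(t,s) = c_H s^{1/2 - H} ∫_s^t w^{H - 1/2} (w - s)^{H - 3/2} dw (with k(t,s)=0 for s ≥ t). Then for every α ∈ ℝ and all 0 < u < t, k(t,u) - α e^{-α t} ∫_u^t e^{α s} k(s,u) ds = c_H e^{-α t} u^{1/2 - H} ∫_u^t e^{α s} s^{H - 1/2} (s - u)^{H - 3/2} ds (all integrals are finite). -/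
open MeasureTheory Real Set intervalIntegral

/-- Integration by parts of `exp (α * x)` against an integrable function and its primitive. -/
lemma integral_exp_mul_eq_sub {f : ℝ → ℝ} {a b : ℝ} (hf : IntervalIntegrable f volume a b)
    (α : ℝ) :
    ∫ x in a..b, Real.exp (α * x) * f x =
      Real.exp (α * b) * (∫ w in a..b, f w) -
        α * ∫ x in a..b, Real.exp (α * x) * ∫ w in a..x, f w := by
  have hexp : AbsolutelyContinuousOnInterval (fun x : ℝ => Real.exp (α * x)) a b :=
    ContDiffOn.absolutelyContinuousOnInterval (by fun_prop)
  have hprim : AbsolutelyContinuousOnInterval (fun x : ℝ => ∫ w in a..x, f w) a b :=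
    hf.absolutelyContinuousOnInterval_intervalIntegral (c := a) (by simp)
  have hparts := hexp.integral_mul_deriv_eq_deriv_mul hprim
  have hderiv : ∀ x : ℝ, deriv (fun y : ℝ => Real.exp (α * y)) x = α * Real.exp (α * x) := by
    intro x
    have h := ((hasDerivAt_id x).const_mul α).exp
    simpa [mul_comm] using h.deriv
  have hae : ∫ x in a..b, Real.exp (α * x) * deriv (fun y => ∫ w in a..y, f w) x =
      ∫ x in a..b, Real.exp (α * x) * f x := by
    apply intervalIntegral.integral_congr_ae
    filter_upwards [hf.ae_hasDerivAt_integral] with x hx hxm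
    rw [(hx (uIoc_subset_uIcc hxm) a left_mem_uIcc).deriv]
  rw [hae] at hparts
  simpa [hderiv, mul_assoc] using hparts

lemma intervalIntegrable_rpow_mul_sub_rpow {p q u t : ℝ} (hq : -1 < q) (hu : 0 < u)
    (hut : u < t) :
    IntervalIntegrable (fun w : ℝ => w ^ p * (w - u) ^ q) volume u t := by
  have hsub : IntervalIntegrable (fun w : ℝ => (w - u) ^ q) volume u t := by
    simpa using (intervalIntegrable_rpow' (a := 0) (b := t - u) hq).comp_sub_right u
  refine hsub.continuousOn_mul fun x hx => ?_
  rw [uIcc_of_le hut.le] at hx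
  exact (continuousAt_rpow_const x p (Or.inl (hu.trans_le hx.1).ne')).continuousWithinAt

theorem stmt_10 (H : ℝ) (hH : H ∈ Set.Ioo (1/2 : ℝ) 1)
    (cH : ℝ)
    (hcH : cH = (H - 1/2) *
      Real.sqrt (2 * H * Real.Gamma (3/2 - H) / (Real.Gamma (H + 1/2) * Real.Gamma (2 - 2 * H))))
    (k : ℝ → ℝ → ℝ)
    (hk : ∀ t s : ℝ, 0 < s → s < t →
      k t s = cH * s ^ ((1:ℝ)/2 - H) * ∫ w in s..t, w ^ (H - 1/2) * (w - s) ^ (H - 3/2))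
    (hk0 : ∀ t s : ℝ, t ≤ s → k t s = 0)
    (α : ℝ) (u t : ℝ) (hu : 0 < u) (hut : u < t) :
    IntervalIntegrable (fun w : ℝ => w ^ (H - 1/2) * (w - u) ^ (H - 3/2)) volume u t ∧
    IntervalIntegrable (fun s : ℝ => Real.exp (α * s) * k s u) volume u t ∧
    IntervalIntegrable (fun s : ℝ =>
      Real.exp (α * s) * s ^ (H - 1/2) * (s - u) ^ (H - 3/2)) volume u t ∧
    k t u - α * Real.exp (-(α * t)) * (∫ s in u..t, Real.exp (α * s) * k s u) =
      cH * Real.exp (-(α * t)) * u ^ ((1:ℝ)/2 - H) *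
        ∫ s in u..t, Real.exp (α * s) * s ^ (H - 1/2) * (s - u) ^ (H - 3/2) := by
  have hf := intervalIntegrable_rpow_mul_sub_rpow (p := H - 1/2) (q := H - 3/2)
    (by linarith [hH.1]) hu hut
  have hker : ∀ s ∈ uIcc u t, Real.exp (α * s) * k s u = cH * u ^ ((1:ℝ)/2 - H) *
      (Real.exp (α * s) * ∫ w in u..s, w ^ (H - 1/2) * (w - u) ^ (H - 3/2)) := by
    intro s hs
    rw [uIcc_of_le hut.le] at hs
    rcases hs.1.eq_or_lt with rfl | hus
    · simp [hk0 u u le_rfl]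
    · rw [hk s u hu hus]
      ring
  have hcont : ContinuousOn (fun s : ℝ => Real.exp (α * s) *
      ∫ w in u..s, w ^ (H - 1/2) * (w - u) ^ (H - 3/2)) (uIcc u t) :=
    ContinuousOn.mul (by fun_prop)
      (hf.absolutelyContinuousOnInterval_intervalIntegral (c := u) (by simp)).continuousOn
  have hexp : ContinuousOn (fun s : ℝ => Real.exp (α * s)) (uIcc u t) := by fun_prop
  refine ⟨hf, ?_, ?_, ?_⟩
  · exact ((continuousOn_const.mul hcont).congr hker).intervalIntegrable
  · simpa only [mul_assoc] using hf.continuousOn_mul hexp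
  · have hassoc : ∀ s : ℝ, Real.exp (α * s) * s ^ (H - 1/2) * (s - u) ^ (H - 3/2) =
        Real.exp (α * s) * (s ^ (H - 1/2) * (s - u) ^ (H - 3/2)) := fun s => mul_assoc _ _ _
    simp only [hassoc]
    rw [integral_exp_mul_eq_sub hf, integral_congr hker, intervalIntegral.integral_const_mul,
      hk t u hu hut]
    have hinv : Real.exp (-(α * t)) * Real.exp (α * t) = 1 := by
      rw [← Real.exp_add, neg_add_cancel, Real.exp_zero]
    linear_combination (-(cH * u ^ ((1:ℝ)/2 - H) *
      ∫ w in u..t, w ^ (H - 1/2) * (w - u) ^ (H - 3/2))) * hinv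
end

section
/- Let T > 0, α > 0 and H ∈ (1/2, 1). For 0 ≤ s ≤ t ≤ T define h_{t,s} : [0,t] → ℝ by h_{t,s}(u) = e^{-α(t-u)} for u ∈ (s,t] and h_{t,s}(u) = e^{-α(t-u)} - e^{-α(s-u)} for u ∈ [0,s]. Then there exists a constant C > 0, depending only on α, T and H, such that for all 0 ≤ s ≤ t ≤ T, ∫₀^t |h_{t,s}(u)|^{1/H} du ≤ C (t - s). -/
open MeasureTheory Real Set intervalIntegral

/-- On `u ≤ s ≤ t` the exponential kernel is Lipschitz in its upper endpoint. -/
lemma abs_exp_sub_exp_le {α s t u : ℝ} (hα : 0 ≤ α) (hst : s ≤ t) (hus : u ≤ s) :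
    |Real.exp (-(α * (t - u))) - Real.exp (-(α * (s - u)))| ≤ min 1 (α * (t - s)) := by
  have hsplit : Real.exp (-(α * (t - u))) =
      Real.exp (-(α * (s - u))) * Real.exp (-(α * (t - s))) := by
    rw [← Real.exp_add]
    ring_nf
  have hs : Real.exp (-(α * (s - u))) ≤ 1 :=
    Real.exp_le_one_iff.mpr (neg_nonpos.mpr (mul_nonneg hα (by linarith)))
  have hst' : 0 ≤ α * (t - s) := mul_nonneg hα (by linarith)
  have hle : Real.exp (-(α * (t - s))) ≤ 1 := Real.exp_le_one_iff.mpr (by linarith)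
  have hlin := Real.add_one_le_exp (-(α * (t - s)))
  have hpos := Real.exp_pos (-(α * (s - u)))
  have hpos' := Real.exp_pos (-(α * (t - s)))
  have habs : |Real.exp (-(α * (t - u))) - Real.exp (-(α * (s - u)))| =
      Real.exp (-(α * (s - u))) * (1 - Real.exp (-(α * (t - s)))) := by
    rw [hsplit, abs_of_nonpos (by nlinarith)]
    ring
  rw [habs]
  refine (mul_le_of_le_one_left (by linarith) hs).trans (le_min ?_ ?_) <;> linarith

theorem stmt_13 (T α H : ℝ) (hT : 0 < T) (hα : 0 < α) (hH : H ∈ Set.Ioo (1/2 : ℝ) 1) :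
    ∃ C > 0, ∀ s t : ℝ, 0 ≤ s → s ≤ t → t ≤ T →
      ∫ u in (0:ℝ)..t,
          |if s < u then Real.exp (-(α * (t - u)))
           else Real.exp (-(α * (t - u))) - Real.exp (-(α * (s - u)))| ^ ((1:ℝ)/H)
        ≤ C * (t - s) := by
  have hH0 : 0 < H := by linarith [hH.1]
  have hp : 1 ≤ 1 / H := by
    rw [le_div_iff₀ hH0]
    linarith [hH.2]
  refine ⟨1 + α * T, by positivity, fun s t hs hst htT => ?_⟩
  set f : ℝ → ℝ := fun u => |if s < u then Real.exp (-(α * (t - u)))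
    else Real.exp (-(α * (t - u))) - Real.exp (-(α * (s - u)))| ^ ((1:ℝ)/H) with hf
  have hts : 0 ≤ t - s := sub_nonneg.mpr hst
  have hf_nonneg (u : ℝ) : 0 ≤ f u := by positivity
  by_cases hint : IntervalIntegrable f volume 0 t
  · have hint₁ : IntervalIntegrable f volume 0 s := hint.mono_set (by
      rw [uIcc_of_le hs, uIcc_of_le (hs.trans hst)]
      exact Icc_subset_Icc_right hst)
    have hint₂ : IntervalIntegrable f volume s t := hint.mono_set (by
      rw [uIcc_of_le hst, uIcc_of_le (hs.trans hst)]
      exact Icc_subset_Icc_left hs)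
    have h₁ : ‖∫ u in (0:ℝ)..s, f u‖ ≤ α * (t - s) * |s - 0| := by
      refine norm_integral_le_of_norm_le_const fun u hu => ?_
      rw [uIoc_of_le hs] at hu
      have hbound := abs_exp_sub_exp_le hα.le hst hu.2
      rw [Real.norm_of_nonneg (hf_nonneg u), hf]
      simp only [if_neg (not_lt.mpr hu.2)]
      calc _ ≤ _ := Real.rpow_le_rpow_of_exponent_ge_of_imp (abs_nonneg _)
            (hbound.trans (min_le_left _ _)) hp (by intros; linarith)
        _ ≤ α * (t - s) := by
          rw [Real.rpow_one]
          exact hbound.trans (min_le_right _ _)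
    have h₂ : ‖∫ u in s..t, f u‖ ≤ 1 * |t - s| := by
      refine norm_integral_le_of_norm_le_const fun u hu => ?_
      rw [uIoc_of_le hst] at hu
      rw [Real.norm_of_nonneg (hf_nonneg u), hf]
      simp only [if_pos hu.1, Real.abs_exp]
      refine Real.rpow_le_one (Real.exp_pos _).le (Real.exp_le_one_iff.mpr ?_) (by positivity)
      exact neg_nonpos.mpr (mul_nonneg hα.le (by linarith [hu.2]))
    rw [← integral_add_adjacent_intervals hint₁ hint₂]
    rw [sub_zero, abs_of_nonneg hs] at h₁
    rw [abs_of_nonneg hts] at h₂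
    have hsT : α * (t - s) * s ≤ α * (t - s) * T :=
      mul_le_mul_of_nonneg_left (hst.trans htT) (by positivity)
    linarith [(le_abs_self _).trans h₁, (le_abs_self _).trans h₂]
  · rw [integral_undef hint]
    positivity
end

section
/- Let a > 0, ε > 0, ϑ ≥ 0 and H ∈ (0,1), and suppose v₀ ∈ (0,a] satisfies ϑ v₀^H < ε. Let τ be a random variable on a probability space such that 0 < τ ≤ a almost surely and P(τ < v) ≤ 2 exp{ -(ε - ϑ v^H)² / (2 v^{2H}) } for all v ∈ (0, v₀). Then for every l > 0, E[τ^{-l}] < ∞. -/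
open MeasureTheory Real Set

theorem exp_neg_le_div_rpow_neg {p y : ℝ} (hp : 0 < p) (hy : 0 < y) :
    Real.exp (-y) ≤ (y / p) ^ (-p) := by
  have hyp : 0 < y / p := div_pos hy hp
  rw [Real.exp_neg, Real.rpow_neg hyp.le]
  refine inv_anti₀ (Real.rpow_pos_of_pos hyp p) ?_
  calc (y / p) ^ p ≤ Real.exp (y / p) ^ p :=
        Real.rpow_le_rpow hyp.le (by linarith [Real.add_one_le_exp (y / p)]) hp.le
    _ = Real.exp y := by rw [← Real.exp_mul, div_mul_cancel₀ y hp.ne']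

theorem exp_neg_div_rpow_le {b H l v : ℝ} (hb : 0 < b) (hH : 0 < H) (hl : 0 < l) (hv : 0 < v) :
    Real.exp (-(b / v ^ (2 * H))) ≤ (b / (l / H)) ^ (-(l / H)) * v ^ (2 * l) := by
  have hvH : 0 < v ^ (2 * H) := Real.rpow_pos_of_pos hv _
  have hp : 0 < l / H := div_pos hl hH
  refine (exp_neg_le_div_rpow_neg hp (div_pos hb hvH)).trans_eq ?_
  rw [div_right_comm, Real.div_rpow (div_pos hb hp).le hvH.le, ← Real.rpow_mul hv.le,
    div_eq_mul_inv, ← Real.rpow_neg hv.le]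
  congr 2
  field_simp

theorem integrable_rpow_neg_of_measure_lt_le {Ω : Type*} [MeasurableSpace Ω] {μ : Measure Ω}
    [IsFiniteMeasure μ] {τ : Ω → ℝ} (hτ : Measurable τ) (hpos : ∀ᵐ ω ∂μ, 0 < τ ω)
    {C l q v₀ : ℝ} (hl : 0 < l) (hq : l < q) (hv₀ : 0 < v₀)
    (htail : ∀ v ∈ Set.Ioo (0:ℝ) v₀, μ {ω | τ ω < v} ≤ ENNReal.ofReal (C * v ^ q)) :
    Integrable (fun ω => τ ω ^ (-l)) μ := by
  have hmeas : Measurable fun ω => τ ω ^ (-l) := hτ.pow_const (-l)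
  have hnn : 0 ≤ᵐ[μ] fun ω => τ ω ^ (-l) := by
    filter_upwards [hpos] with ω hω using Real.rpow_nonneg hω.le _
  refine ⟨hmeas.aestronglyMeasurable, ?_⟩
  rw [hasFiniteIntegral_iff_ofReal hnn, lintegral_eq_lintegral_meas_lt μ hnn hmeas.aemeasurable]
  set T : ℝ := v₀ ^ (-l)
  have hT0 : 0 < T := Real.rpow_pos_of_pos hv₀ _
  have hsmall : ∫⁻ t in Ioc 0 T, μ {ω | t < τ ω ^ (-l)} < ⊤ := by
    refine (lintegral_mono fun t => measure_mono (subset_univ _)).trans_lt ?_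
    rw [setLIntegral_const, Real.volume_Ioc]
    exact ENNReal.mul_lt_top (measure_lt_top μ _) ENNReal.ofReal_lt_top
  have hbound : ∀ t ∈ Ioi T, μ {ω | t < τ ω ^ (-l)} ≤ ENNReal.ofReal (C * t ^ (-(q / l))) := by
    intro t ht
    have ht0 : 0 < t := hT0.trans ht
    have hlt : t ^ (-l)⁻¹ < v₀ :=
      (Real.rpow_inv_lt_iff_of_neg ht0 hv₀ (neg_lt_zero.2 hl)).2 ht
    have hexp : t ^ (-(q / l)) = (t ^ (-l)⁻¹) ^ q := by
      rw [← Real.rpow_mul ht0.le]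
      congr 1
      field_simp
    rw [hexp]
    refine le_trans (measure_mono_ae ?_) (htail _ ⟨Real.rpow_pos_of_pos ht0 _, hlt⟩)
    filter_upwards [hpos] with ω hω h
    exact (Real.lt_rpow_inv_iff_of_neg hω ht0 (neg_lt_zero.2 hl)).2 h
  have hlarge : ∫⁻ t in Ioi T, μ {ω | t < τ ω ^ (-l)} < ⊤ :=
    (setLIntegral_mono' measurableSet_Ioi hbound).trans_lt
      ((integrableOn_Ioi_rpow_of_lt (neg_lt_neg ((one_lt_div hl).2 hq)) hT0).const_mul
        C).lintegral_lt_top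
  rw [← Ioc_union_Ioi_eq_Ioi hT0.le]
  exact (lintegral_union_le _ _ _).trans_lt (ENNReal.add_lt_top.2 ⟨hsmall, hlarge⟩)

theorem stmt_15 {Ω : Type*} [MeasurableSpace Ω] (μ : Measure Ω) [IsProbabilityMeasure μ]
    (a ε ϑ H : ℝ) (ha : 0 < a) (hε : 0 < ε) (hϑ : 0 ≤ ϑ) (hH : H ∈ Set.Ioo (0:ℝ) 1)
    (v₀ : ℝ) (hv₀ : v₀ ∈ Set.Ioc (0:ℝ) a) (hv₀ε : ϑ * v₀ ^ H < ε)
    (τ : Ω → ℝ) (hτ : Measurable τ)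
    (hτbound : ∀ᵐ ω ∂μ, 0 < τ ω ∧ τ ω ≤ a)
    (htail : ∀ v ∈ Set.Ioo (0:ℝ) v₀,
      μ {ω | τ ω < v} ≤
        ENNReal.ofReal (2 * Real.exp (-(ε - ϑ * v ^ H) ^ 2 / (2 * v ^ (2 * H))))) :
    ∀ l : ℝ, 0 < l → Integrable (fun ω => τ ω ^ (-l)) μ := by
  intro l hl
  have hc : 0 < ε - ϑ * v₀ ^ H := sub_pos.2 hv₀ε
  set b : ℝ := (ε - ϑ * v₀ ^ H) ^ 2 / 2
  have hb : 0 < b := by positivity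
  refine integrable_rpow_neg_of_measure_lt_le hτ (hτbound.mono fun ω h => h.1)
    (C := 2 * (b / (l / H)) ^ (-(l / H))) (q := 2 * l) hl (by linarith) hv₀.1 fun v hv => ?_
  refine (htail v hv).trans (ENNReal.ofReal_le_ofReal ?_)
  rw [mul_assoc]
  refine mul_le_mul_of_nonneg_left ?_ zero_le_two
  refine (Real.exp_le_exp.2 ?_).trans (exp_neg_div_rpow_le hb hH.1 hl hv.1)
  have hmono : ε - ϑ * v₀ ^ H ≤ ε - ϑ * v ^ H :=
    sub_le_sub_left
      (mul_le_mul_of_nonneg_left (Real.rpow_le_rpow hv.1.le hv.2.le hH.1.le) hϑ) ε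
  have hvH : 0 < v ^ (2 * H) := Real.rpow_pos_of_pos hv.1 _
  rw [neg_div, neg_le_neg_iff, div_div]
  exact div_le_div_of_nonneg_right (pow_le_pow_left₀ hc.le hmono 2) (by positivity)
end
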